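/- arXiv:1103.5500 — 6 statements merged into one kernel-verified Lean document; each statement's English description precedes it below -/
import Mathlib

section
/- If J is a proper ℤ^n-invariant ideal of R, then the group homomorphism ℤ^n → Aut_K(R/J) induced by the action σ is injective; that is, if g ∈ ℤ^n satisfies σ_g(r) − r ∈ J for all r ∈ R, then g = 0. -/
/-!
Multiparameter twisted Weyl algebras (Futorny–Hartwig).
Setup: `LR K n` is the Laurent polynomial ring `K[u₁^{±1},…,uₙ^{±1},v₁^{±1},…,vₙ^{±1}]`,
realized as the group algebra of `ℤ^n × ℤ^n` over `K`; `σ i` are the commuting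
`K`-algebra automorphisms determined by `σ i (u j) = r i j⁻¹ • u j`,
`σ i (v j) = s i j⁻¹ • v j`, and `σ_g = σ₁^{g₁} ⋯ σₙ^{gₙ}` for `g ∈ ℤ^n`.
-/

namespace MTW

abbrev Exp (n : ℕ) : Type := (Fin n → ℤ) × (Fin n → ℤ)

abbrev LR (K : Type) [Field K] (n : ℕ) : Type := AddMonoidAlgebra K (Exp n)

noncomputable def mon (K : Type) [Field K] (n : ℕ) (d : Exp n) : LR K n :=
  AddMonoidAlgebra.single d 1

noncomputable def U (K : Type) [Field K] (n : ℕ) (j : Fin n) : LR K n :=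
  mon K n (Pi.single j 1, 0)

noncomputable def V (K : Type) [Field K] (n : ℕ) (j : Fin n) : LR K n :=
  mon K n (0, Pi.single j 1)

noncomputable def sigmaZ (K : Type) [Field K] (n : ℕ)
    (σ : Fin n → (LR K n ≃ₐ[K] LR K n)) (g : Fin n → ℤ) : LR K n ≃ₐ[K] LR K n :=
  (List.ofFn fun i => σ i ^ (g i)).prod

def IsInvariantIdeal (K : Type) [Field K] (n : ℕ)
    (σ : Fin n → (LR K n ≃ₐ[K] LR K n)) (J : Ideal (LR K n)) : Prop :=
  ∀ (g : Fin n → ℤ), ∀ x ∈ J, sigmaZ K n σ g x ∈ J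

/-- A common eigenvector of the `σ i` is an eigenvector of `sigmaZ K n σ g`. -/
theorem sigmaZ_apply_of_eigenvector {K : Type} [Field K] {n : ℕ}
    {σ : Fin n → (LR K n ≃ₐ[K] LR K n)} {x : LR K n} {c : Fin n → K}
    (hc : ∀ i, c i ≠ 0) (h : ∀ i, σ i x = c i • x) (g : Fin n → ℤ) :
    sigmaZ K n σ g x = (∏ i, c i ^ g i) • x := by
  have hnat : ∀ i (m : ℕ), (σ i ^ m) x = c i ^ m • x := by
    intro i m
    induction m with
    | zero => simp
    | succ m ih => rw [pow_succ, AlgEquiv.mul_apply, h, map_smul, ih, smul_smul, pow_succ']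
  have hint : ∀ i (m : ℤ), (σ i ^ m) x = c i ^ m • x := by
    intro i m
    obtain ⟨m, rfl | rfl⟩ := m.eq_nat_or_neg
    · simpa using hnat i m
    · apply (σ i ^ m).injective
      rw [← AlgEquiv.mul_apply, zpow_neg, zpow_natCast, mul_inv_cancel, AlgEquiv.one_apply,
        map_smul, hnat, smul_smul, zpow_neg, zpow_natCast,
        inv_mul_cancel₀ (pow_ne_zero m (hc i)), one_smul]
  have hlist : ∀ l : List (Fin n), (l.map fun i => σ i ^ g i).prod x =
      (l.map fun i => c i ^ g i).prod • x := by
    intro l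
    induction l with
    | nil => simp
    | cons i l ih =>
      simp only [List.map_cons, List.prod_cons, AlgEquiv.mul_apply]
      rw [ih, map_smul, hint, smul_smul, mul_comm]
  rw [sigmaZ, List.ofFn_eq_map, hlist, ← List.ofFn_eq_map, List.prod_ofFn]

theorem isUnit_mon (K : Type) [Field K] (n : ℕ) (d : Exp n) : IsUnit (mon K n d) :=
  IsUnit.of_mul_eq_one (mon K n (-d)) (by
    simp [mon, AddMonoidAlgebra.single_mul_single, AddMonoidAlgebra.one_def])

/-- A scalar which fixes a unit modulo a proper ideal is `1`. -/
theorem eq_one_of_smul_sub_mem {K A : Type*} [Field K] [CommRing A] [Algebra K A]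
    {J : Ideal A} (hJ : J ≠ ⊤) {x : A} (hx : IsUnit x) {c : K} (h : c • x - x ∈ J) : c = 1 := by
  by_contra hc
  apply hJ
  refine Ideal.eq_top_of_isUnit_mem J h ?_
  have hcx : c • x - x = algebraMap K A (c - 1) * x := by
    rw [← Algebra.smul_def, sub_smul, one_smul]
  rw [hcx]
  exact ((sub_ne_zero.mpr hc).isUnit.map (algebraMap K A)).mul hx

/-- If `J` is a proper `ℤ^n`-invariant ideal of `R`, then the induced
group homomorphism `ℤ^n → Aut_K(R/J)` is injective: if `σ_g(r) - r ∈ J` for all `r ∈ R`,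
then `g = 0`. -/
theorem statement0 (K : Type) [Field K] (n : ℕ) (hn : 0 < n)
    (k : ℤ) (hk : k ≠ 0) (r s : Fin n → Fin n → K)
    (hr : ∀ i j, r i j ≠ 0) (hs : ∀ i j, s i j ≠ 0)
    (hroot : ∀ i, ∀ m : ℕ, 0 < m → (r i i / s i i) ^ m ≠ 1)
    (hrs : ∀ i j, i ≠ j → r i j ^ k = s i j ^ k)
    (σ : Fin n → (LR K n ≃ₐ[K] LR K n))
    (hσu : ∀ i j, σ i (U K n j) = (r i j)⁻¹ • U K n j)
    (hσv : ∀ i j, σ i (V K n j) = (s i j)⁻¹ • V K n j)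
    (J : Ideal (LR K n)) (hJ : J ≠ ⊤) (hJinv : IsInvariantIdeal K n σ J)
    (g : Fin n → ℤ) (hg : ∀ x : LR K n, sigmaZ K n σ g x - x ∈ J) :
    g = 0 := by
  have key : ∀ {d : Exp n} {c : Fin n → K}, (∀ i, c i ≠ 0) →
      (∀ i, σ i (mon K n d) = (c i)⁻¹ • mon K n d) → ∏ i, c i ^ g i = 1 := by
    intro d c hc h
    have hd := hg (mon K n d)
    rw [sigmaZ_apply_of_eigenvector (fun i => inv_ne_zero (hc i)) h] at hd
    simpa using eq_one_of_smul_sub_mem hJ (isUnit_mon K n d) hd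
  funext j
  have hu : ∏ i, r i j ^ g i = 1 := key (fun i => hr i j) fun i => hσu i j
  have hv : ∏ i, s i j ^ g i = 1 := key (fun i => hs i j) fun i => hσv i j
  have hprod : ∏ i, ((r i j / s i j) ^ k) ^ g i = 1 := by
    simp only [zpow_comm _ k, Finset.prod_zpow, div_zpow, Finset.prod_div_distrib, hu, hv,
      div_one, one_zpow]
  rw [Finset.prod_eq_single j (fun i _ hij => by
      rw [div_zpow, hrs i j hij, div_self (zpow_ne_zero k (hs i j)), one_zpow]) (by simp),
    ← zpow_mul] at hprod
  by_contra hgj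
  have hne : k * g j ≠ 0 := mul_ne_zero hk hgj
  refine hroot j (k * g j).natAbs (Int.natAbs_pos.mpr hne) ?_
  rcases Int.natAbs_eq (k * g j) with h | h <;> rw [h] at hprod
  · rwa [zpow_natCast] at hprod
  · rwa [zpow_neg, inv_eq_one, zpow_natCast] at hprod

end MTW
end

section
/- The maps ε : 𝔫 ↦ R𝔫 (the ideal of R generated by 𝔫) and ρ : J ↦ J ∩ R^{ℤ^n} are mutually inverse, inclusion-preserving bijections between the set of ideals of the invariant subring R^{ℤ^n} and the set of ℤ^n-invariant ideals of R. -/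
namespace MTW

noncomputable def tElt (K : Type) [Field K] (n : ℕ) (k : ℤ) (r s : Fin n → Fin n → K)
    (i : Fin n) : LR K n :=
  (r i i ^ k - s i i ^ k)⁻¹ •
    (r i i ^ k • mon K n (Pi.single i k, 0) - s i i ^ k • mon K n (0, Pi.single i k))

noncomputable def invariants (K : Type) [Field K] (n : ℕ)
    (σ : Fin n → (LR K n ≃ₐ[K] LR K n)) : Subalgebra K (LR K n) :=
  ⨅ i, AlgHom.equalizer (σ i).toAlgHom (AlgHom.id K (LR K n))

section Diagonal

variable {K G ι : Type*} [Field K]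

open AddMonoidAlgebra

open Classical in
/-- The projection onto the span of the monomials of weight one for every member of a family. -/
noncomputable def weightOneProj (w : ι → G → K) (f : K[G]) : K[G] :=
  .ofCoeff (f.coeff.filter fun d => ∀ i, w i d = 1)

open Classical in
lemma coeff_weightOneProj (w : ι → G → K) (f : K[G]) (d : G) :
    (weightOneProj w f).coeff d = if ∀ i, w i d = 1 then f.coeff d else 0 := by
  simp [weightOneProj, Finsupp.filter_apply]

lemma weightOneProj_add (w : ι → G → K) (f g : K[G]) :
    weightOneProj w (f + g) = weightOneProj w f + weightOneProj w g := by
  classical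
  ext d
  simp only [coeff_add, Finsupp.add_apply, coeff_weightOneProj]
  split_ifs <;> simp

variable [AddCommGroup G]

/-- An algebra automorphism of a group algebra scaling every monomial scales the coefficients. -/
lemma coeff_apply_of_scales {φ : K[G] ≃ₐ[K] K[G]} {w : G → K}
    (hw : ∀ d, φ (single d 1) = w d • single d 1) (f : K[G]) (d : G) :
    (φ f).coeff d = w d * f.coeff d := by
  classical
  induction f using AddMonoidAlgebra.induction_linear with
  | zero => simp
  | add f g hf hg => simp [hf, hg, mul_add]
  | single e c =>
    have h : (single e c : K[G]) = c • single e 1 := by simp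
    rw [h, map_smul, hw]
    by_cases hed : e = d
    · subst hed; simp [mul_comm]
    · simp [hed]

lemma weight_add {φ : K[G] ≃ₐ[K] K[G]} {w : G → K}
    (hw : ∀ d, φ (single d 1) = w d • single d 1) (d e : G) : w (d + e) = w d * w e := by
  have h : (single (d + e) 1 : K[G]) = single d 1 * single e 1 := by simp [single_mul_single]
  have h' := hw (d + e)
  rw [h, map_mul, hw, hw, smul_mul_smul_comm, ← h] at h'
  simpa using (congrArg (fun f => f.coeff (d + e)) h').symm

lemma weight_zero {φ : K[G] ≃ₐ[K] K[G]} {w : G → K}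
    (hw : ∀ d, φ (single d 1) = w d • single d 1) : w 0 = 1 := by
  have h := hw 0
  rw [← one_def, map_one] at h
  simpa using (congrArg (fun f => f.coeff 0) h).symm

lemma apply_eq_self_iff_of_scales {φ : K[G] ≃ₐ[K] K[G]} {w : G → K}
    (hw : ∀ d, φ (single d 1) = w d • single d 1) (f : K[G]) :
    φ f = f ↔ ∀ d, f.coeff d ≠ 0 → w d = 1 := by
  constructor
  · intro h d hd
    have := coeff_apply_of_scales hw f d
    rw [h] at this
    exact mul_right_cancel₀ hd (by rw [← this, one_mul])
  · intro h
    ext d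
    rw [coeff_apply_of_scales hw]
    by_cases hd : f.coeff d = 0
    · simp [hd]
    · rw [h d hd, one_mul]

/-- An ideal stable under a family of diagonal automorphisms is generated by its fixed elements. -/
lemma le_of_forall_fixed_mem {φ : ι → (K[G] ≃ₐ[K] K[G])} {w : ι → G → K}
    (hw : ∀ i d, φ i (single d 1) = w i d • single d 1) {I J : Ideal K[G]}
    (hJ : ∀ i, ∀ f ∈ J, φ i f ∈ J) (hI : ∀ f ∈ J, (∀ i, φ i f = f) → f ∈ I) : J ≤ I := by
  classical
  have smul_mem' (L : Ideal K[G]) (c : K) {f : K[G]} (hf : f ∈ L) : c • f ∈ L :=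
    Submodule.smul_of_tower_mem L c hf
  intro f hf
  induction hN : f.coeff.support.card using Nat.strong_induction_on generalizing f with
  | _ N ih =>
  subst hN
  by_cases hf0 : f = 0
  · simp [hf0]
  obtain ⟨d, hd⟩ : ∃ d, f.coeff d ≠ 0 := by
    by_contra! h
    exact hf0 (by ext d; simpa using h d)
  have drop (i : ι) (e : G) (he : f.coeff e ≠ 0) : φ i f - w i e • f ∈ I := by
    refine ih _ ?_ (J.sub_mem (hJ i f hf) (smul_mem' J _ hf)) rfl
    refine Finset.card_lt_card ⟨fun x hx => ?_, fun h => ?_⟩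
    · simp only [Finsupp.mem_support_iff, coeff_sub, Finsupp.sub_apply, coeff_smul,
        Finsupp.smul_apply, coeff_apply_of_scales (hw i), smul_eq_mul] at hx ⊢
      rintro h
      simp [h] at hx
    · have := h (Finsupp.mem_support_iff.2 he)
      simp [coeff_apply_of_scales (hw i)] at this
  by_cases hall : ∀ i e, f.coeff e ≠ 0 → w i e = w i d
  · have hg : (single (-d) 1 : K[G]) * f ∈ I := by
      refine hI _ (J.mul_mem_left _ hf) fun i => ?_
      rw [apply_eq_self_iff_of_scales (hw i)]
      intro e he
      have h1 : f.coeff (d + e) ≠ 0 := by simpa using he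
      have h2 := hall i _ h1
      have h3 : w i d * w i (-d) = 1 := by
        rw [← weight_add (hw i), add_neg_cancel, weight_zero (hw i)]
      rw [weight_add (hw i)] at h2
      exact mul_left_cancel₀ (left_ne_zero_of_mul_eq_one h3) (by rw [h2, mul_one])
    have := I.mul_mem_left (single d 1) hg
    rwa [← mul_assoc, single_mul_single, add_neg_cancel, one_mul, ← one_def, one_mul] at this
  · push Not at hall
    obtain ⟨i, e, he, hne⟩ := hall
    have h := I.sub_mem (drop i d hd) (drop i e he)
    rw [sub_sub_sub_cancel_left, ← sub_smul] at h
    have := smul_mem' I (w i e - w i d)⁻¹ h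
    rwa [smul_smul, inv_mul_cancel₀ (sub_ne_zero.2 hne), one_smul] at this

lemma apply_weightOneProj {φ : ι → (K[G] ≃ₐ[K] K[G])} {w : ι → G → K}
    (hw : ∀ i d, φ i (single d 1) = w i d • single d 1) (f : K[G]) (i : ι) :
    φ i (weightOneProj w f) = weightOneProj w f := by
  classical
  rw [apply_eq_self_iff_of_scales (hw i)]
  intro d hd
  rw [coeff_weightOneProj] at hd
  by_contra h
  exact hd (if_neg fun h' => h (h' i))

lemma weightOneProj_of_fixed {φ : ι → (K[G] ≃ₐ[K] K[G])} {w : ι → G → K}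
    (hw : ∀ i d, φ i (single d 1) = w i d • single d 1) {f : K[G]} (hf : ∀ i, φ i f = f) :
    weightOneProj w f = f := by
  classical
  ext d
  rw [coeff_weightOneProj]
  split_ifs with h
  · rfl
  · by_contra hd
    exact h fun i => (apply_eq_self_iff_of_scales (hw i) f).1 (hf i) d (Ne.symm hd)

lemma weightOneProj_mul_of_fixed {φ : ι → (K[G] ≃ₐ[K] K[G])} {w : ι → G → K}
    (hw : ∀ i d, φ i (single d 1) = w i d • single d 1) (a : K[G]) {b : K[G]}
    (hb : ∀ i, φ i b = b) : weightOneProj w (a * b) = weightOneProj w a * b := by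
  classical
  induction a using AddMonoidAlgebra.induction_linear with
  | zero =>
    have h : weightOneProj w 0 = 0 := weightOneProj_of_fixed hw fun i => map_zero _
    simp [h]
  | add f g hf hg => rw [add_mul, weightOneProj_add, hf, hg, weightOneProj_add, add_mul]
  | single d c =>
    have hproj : weightOneProj w (single d c) = if ∀ i, w i d = 1 then single d c else 0 := by
      ext e
      rw [coeff_weightOneProj]
      by_cases hde : d = e
      · subst hde; split_ifs <;> simp
      · split_ifs <;> simp [hde]
    have hwt (e : G) (he : b.coeff (-d + e) ≠ 0) (i : ι) : w i e = w i d := by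
      have h1 := (apply_eq_self_iff_of_scales (hw i) b).1 (hb i) _ he
      have h2 := weight_add (hw i) d (-d + e)
      rwa [h1, mul_one, add_neg_cancel_left] at h2
    ext e
    rw [hproj, coeff_weightOneProj]
    by_cases he : b.coeff (-d + e) = 0
    · split_ifs <;> simp [he]
    · simp only [hwt e he]
      split_ifs <;> simp

/-- Extending an ideal from the fixed subalgebra of diagonal automorphisms and contracting it
gives the ideal back. -/
lemma comap_map_val_of_scales {φ : ι → (K[G] ≃ₐ[K] K[G])} {w : ι → G → K}
    (hw : ∀ i d, φ i (single d 1) = w i d • single d 1) {A : Subalgebra K K[G]}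
    (hA : ∀ f, f ∈ A ↔ ∀ i, φ i f = f) (I : Ideal A) :
    Ideal.comap A.val (Ideal.map A.val I) = I := by
  refine le_antisymm (fun y hy => ?_) Ideal.le_comap_map
  have hmem (f : K[G]) : weightOneProj w f ∈ A := (hA _).2 (apply_weightOneProj hw f)
  have key : ∀ x ∈ Ideal.map A.val I, ∀ a, (⟨weightOneProj w (a * x), hmem _⟩ : A) ∈ I := by
    intro x hx
    induction hx using Submodule.span_induction with
    | mem x hx =>
      obtain ⟨b, hb, rfl⟩ := hx
      intro a
      convert I.mul_mem_left ⟨weightOneProj w a, hmem a⟩ hb using 1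
      exact Subtype.ext (weightOneProj_mul_of_fixed hw a ((hA _).1 b.2))
    | zero =>
      intro a
      convert I.zero_mem using 1
      refine Subtype.ext ?_
      simpa using weightOneProj_of_fixed hw fun i => map_zero (φ i)
    | add x y _ _ hx hy =>
      intro a
      convert I.add_mem (hx a) (hy a) using 1
      exact Subtype.ext (by simp [mul_add, weightOneProj_add])
    | smul c x _ hx =>
      intro a
      convert hx (a * c) using 3
      rw [smul_eq_mul, mul_assoc]
  convert key _ hy 1 using 1
  refine Subtype.ext ?_
  rw [one_mul]
  exact (weightOneProj_of_fixed hw ((hA _).1 y.2)).symm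

end Diagonal

/-- A product over `Fin n` with a single nontrivial factor equals that factor. -/
lemma prod_ofFn_eq_of_forall_ne {M : Type*} [Monoid M] {n : ℕ} (f : Fin n → M) (i : Fin n)
    (h : ∀ j, j ≠ i → f j = 1) : (List.ofFn f).prod = f i := by
  induction n with
  | zero => exact i.elim0
  | succ n ih =>
    rw [List.ofFn_succ, List.prod_cons]
    cases i using Fin.cases with
    | zero =>
      have : (List.ofFn fun j : Fin n => f j.succ).prod = 1 :=
        List.prod_eq_one fun x hx => by
          obtain ⟨j, rfl⟩ := (List.mem_ofFn' _ _).1 hx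
          exact h _ (Fin.succ_ne_zero j)
      rw [this, mul_one]
    | succ i =>
      rw [h 0 (Fin.succ_ne_zero i).symm, one_mul]
      exact ih (fun j => f j.succ) i fun j hj => h _ fun e => hj (Fin.succ_injective _ e)

lemma sigmaZ_single {K : Type} [Field K] {n : ℕ} (σ : Fin n → (LR K n ≃ₐ[K] LR K n))
    (i : Fin n) : sigmaZ K n σ (Pi.single i 1) = σ i := by
  rw [sigmaZ, prod_ofFn_eq_of_forall_ne _ i fun j hj => by simp [hj]]
  simp

lemma sigmaZ_apply_of_fixed {K : Type} [Field K] {n : ℕ} {σ : Fin n → (LR K n ≃ₐ[K] LR K n)}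
    {f : LR K n} (hf : ∀ i, σ i f = f) (g : Fin n → ℤ) : sigmaZ K n σ g f = f := by
  have : sigmaZ K n σ g ∈ MulAction.stabilizer (LR K n ≃ₐ[K] LR K n) f := by
    refine Subgroup.list_prod_mem _ fun x hx => ?_
    obtain ⟨i, rfl⟩ := (List.mem_ofFn' _ _).1 hx
    exact Subgroup.zpow_mem _ (hf i) _
  exact this

lemma mem_invariants_iff {K : Type} [Field K] {n : ℕ} {σ : Fin n → (LR K n ≃ₐ[K] LR K n)}
    {f : LR K n} : f ∈ invariants K n σ ↔ ∀ i, σ i f = f := by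
  simp [invariants, Algebra.mem_iInf, AlgHom.mem_equalizer]

/-- An automorphism scaling the variables scales every monomial. -/
lemma exists_scales_mon {K : Type} [Field K] {n : ℕ} (φ : LR K n ≃ₐ[K] LR K n) {a b : Fin n → K}
    (hu : ∀ j, φ (U K n j) = a j • U K n j) (hv : ∀ j, φ (V K n j) = b j • V K n j) (d : Exp n) :
    ∃ c : K, φ (mon K n d) = c • mon K n d := by
  have mon_add (d e : Exp n) : mon K n (d + e) = mon K n d * mon K n e := by
    simp [mon, AddMonoidAlgebra.single_mul_single]
  have mon_zero : mon K n 0 = 1 := rfl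
  let E : AddSubgroup (Exp n) :=
    { carrier := {d | ∃ c : K, φ (mon K n d) = c • mon K n d}
      zero_mem' := ⟨1, by rw [mon_zero, map_one, one_smul]⟩
      add_mem' := by
        rintro d e ⟨x, hx⟩ ⟨y, hy⟩
        exact ⟨x * y, by rw [mon_add, map_mul, hx, hy, smul_mul_smul_comm]⟩
      neg_mem' := by
        rintro d ⟨x, hx⟩
        have hinv : mon K n d * mon K n (-d) = 1 := by rw [← mon_add, add_neg_cancel, mon_zero]
        have h1 : x • (mon K n d * φ (mon K n (-d))) = 1 := by
          rw [← smul_mul_assoc, ← hx, ← map_mul, hinv, map_one]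
        have hx0 : x ≠ 0 := by
          rintro rfl
          simp at h1
        have h2 : x • φ (mon K n (-d)) = mon K n (-d) := by
          calc x • φ (mon K n (-d))
              = (mon K n d * mon K n (-d)) * x • φ (mon K n (-d)) := by rw [hinv, one_mul]
            _ = mon K n (-d) * x • (mon K n d * φ (mon K n (-d))) := by
              simp only [mul_smul_comm]; congr 1; ring
            _ = mon K n (-d) := by rw [h1, mul_one]
        exact ⟨x⁻¹, (inv_smul_eq_iff₀ hx0).2 h2.symm |>.symm⟩ }
  have hd : d =
      ∑ j, (d.1 j • ((Pi.single j 1, 0) : Exp n) + d.2 j • ((0, Pi.single j 1) : Exp n)) := by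
    ext j <;> simp [Prod.fst_sum, Prod.snd_sum, Finset.sum_apply, Pi.single_apply]
  change d ∈ E
  rw [hd]
  exact E.sum_mem fun j _ => E.add_mem (E.zsmul_mem ⟨a j, hu j⟩ _) (E.zsmul_mem ⟨b j, hv j⟩ _)

/-- The maps `ε : 𝔫 ↦ R𝔫` and `ρ : J ↦ J ∩ R^{ℤ^n}` are mutually
inverse, inclusion-preserving bijections between the ideals of the invariant subring
`R^{ℤ^n}` and the `ℤ^n`-invariant ideals of `R`. -/
theorem statement1
    (K : Type) [Field K] (n : ℕ) (hn : 0 < n)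
    (k : ℤ) (hk : k ≠ 0) (r s : Fin n → Fin n → K)
    (hr : ∀ i j, r i j ≠ 0) (hs : ∀ i j, s i j ≠ 0)
    (hroot : ∀ i, ∀ m : ℕ, 0 < m → (r i i / s i i) ^ m ≠ 1)
    (hrs : ∀ i j, i ≠ j → r i j ^ k = s i j ^ k)
    (σ : Fin n → (LR K n ≃ₐ[K] LR K n))
    (hσu : ∀ i j, σ i (U K n j) = (r i j)⁻¹ • U K n j)
    (hσv : ∀ i j, σ i (V K n j) = (s i j)⁻¹ • V K n j)
    :
    (∀ 𝔫 : Ideal (invariants K n σ),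
        IsInvariantIdeal K n σ (Ideal.map (invariants K n σ).val 𝔫) ∧
        Ideal.comap (invariants K n σ).val (Ideal.map (invariants K n σ).val 𝔫) = 𝔫) ∧
    (∀ J : Ideal (LR K n), IsInvariantIdeal K n σ J →
        Ideal.map (invariants K n σ).val (Ideal.comap (invariants K n σ).val J) = J) ∧
    (∀ 𝔫₁ 𝔫₂ : Ideal (invariants K n σ), 𝔫₁ ≤ 𝔫₂ →
        Ideal.map (invariants K n σ).val 𝔫₁ ≤ Ideal.map (invariants K n σ).val 𝔫₂) ∧
    (∀ J₁ J₂ : Ideal (LR K n), IsInvariantIdeal K n σ J₁ → IsInvariantIdeal K n σ J₂ →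
        J₁ ≤ J₂ →
        Ideal.comap (invariants K n σ).val J₁ ≤ Ideal.comap (invariants K n σ).val J₂) := by
  have hex (i : Fin n) (d : Exp n) := exists_scales_mon (σ i) (hσu i) (hσv i) d
  choose w hw using hex
  refine ⟨fun 𝔫 => ⟨fun g x hx => ?_, comap_map_val_of_scales hw (fun _ => mem_invariants_iff) 𝔫⟩,
    fun J hJ => le_antisymm Ideal.map_comap_le ?_, fun _ _ h => Ideal.map_mono h,
    fun _ _ _ _ h => Ideal.comap_mono h⟩
  · have hle : Ideal.map (invariants K n σ).val 𝔫 ≤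
        Ideal.comap (sigmaZ K n σ g) (Ideal.map (invariants K n σ).val 𝔫) := by
      rw [Ideal.map_le_iff_le_comap]
      intro y hy
      have hfix := sigmaZ_apply_of_fixed (mem_invariants_iff.1 y.2) g
      rw [Ideal.mem_comap, Ideal.mem_comap, Subalgebra.val_apply, hfix]
      exact Ideal.mem_map_of_mem (invariants K n σ).val hy
    exact hle hx
  · refine le_of_forall_fixed_mem hw (fun i f hf => ?_) fun f hf hfix => ?_
    · simpa [sigmaZ_single] using hJ (Pi.single i 1) f hf
    · have hmem : (⟨f, mem_invariants_iff.2 hfix⟩ : invariants K n σ) ∈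
          Ideal.comap (invariants K n σ).val J := hf
      exact Ideal.mem_map_of_mem (invariants K n σ).val hmem

end MTW
end

section
/- For every maximal ideal 𝔫 of R^{ℤ^n}, the ideal R𝔫 of R generated by 𝔫 is maximal among proper ℤ^n-invariant ideals of R; conversely, every ideal of R that is maximal among proper ℤ^n-invariant ideals equals R𝔫 for some maximal ideal 𝔫 of R^{ℤ^n}. -/
namespace MTW

section Monomials

variable {K : Type} [Field K] {n : ℕ}

lemma mon_zero : mon K n 0 = 1 := rfl

lemma mon_add (d e : Exp n) : mon K n (d + e) = mon K n d * mon K n e := by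
  simp [mon, AddMonoidAlgebra.single_mul_single]

lemma mon_mul_mon_neg (d : Exp n) : mon K n d * mon K n (-d) = 1 := by
  rw [← mon_add, add_neg_cancel, mon_zero]

lemma mon_ne_zero (d : Exp n) : mon K n d ≠ 0 :=
  AddMonoidAlgebra.single_ne_zero.2 one_ne_zero

lemma exp_eq_sum (d : Exp n) :
    d = ∑ j, d.1 j • ((Pi.single j 1, 0) : Exp n) + ∑ j, d.2 j • ((0, Pi.single j 1) : Exp n) := by
  ext l <;> simp [Prod.fst_sum, Prod.snd_sum, Finset.sum_apply, Pi.single_apply]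

/-- The exponents of the monomials that are eigenvectors of a given automorphism. -/
noncomputable def eigenExponents (τ : LR K n ≃ₐ[K] LR K n) : AddSubgroup (Exp n) where
  carrier := {d | ∃ c : K, c ≠ 0 ∧ τ (mon K n d) = c • mon K n d}
  zero_mem' := ⟨1, one_ne_zero, by simp [mon_zero]⟩
  add_mem' := by
    rintro d e ⟨a, ha, hd⟩ ⟨b, hb, he⟩
    refine ⟨a * b, mul_ne_zero ha hb, ?_⟩
    rw [mon_add, map_mul, hd, he, smul_mul_smul_comm]
  neg_mem' := by
    rintro d ⟨c, hc, hd⟩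
    refine ⟨c⁻¹, inv_ne_zero hc, ?_⟩
    have h : τ (mon K n d) * τ (mon K n (-d)) = 1 := by
      rw [← map_mul, mon_mul_mon_neg, map_one]
    rw [hd, smul_mul_assoc] at h
    calc τ (mon K n (-d)) = (mon K n d * mon K n (-d)) * τ (mon K n (-d)) := by
          rw [mon_mul_mon_neg, one_mul]
      _ = c⁻¹ • ((c • (mon K n d * τ (mon K n (-d)))) * mon K n (-d)) := by
          rw [smul_mul_assoc, smul_smul, inv_mul_cancel₀ hc, one_smul]; ring
      _ = c⁻¹ • mon K n (-d) := by rw [h, one_mul]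

lemma exists_eigenvalue (τ : LR K n ≃ₐ[K] LR K n)
    (hU : ∀ j, ∃ c : K, c ≠ 0 ∧ τ (U K n j) = c • U K n j)
    (hV : ∀ j, ∃ c : K, c ≠ 0 ∧ τ (V K n j) = c • V K n j) (d : Exp n) :
    ∃ c : K, τ (mon K n d) = c • mon K n d := by
  have h : d ∈ eigenExponents τ := by
    rw [exp_eq_sum d]
    exact add_mem (sum_mem fun j _ => zsmul_mem (hU j) _) (sum_mem fun j _ => zsmul_mem (hV j) _)
  obtain ⟨c, -, hc⟩ := h
  exact ⟨c, hc⟩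

lemma coeff_eigen {τ : LR K n ≃ₐ[K] LR K n} {w : Exp n → K}
    (hw : ∀ d, τ (mon K n d) = w d • mon K n d) (x : LR K n) (d : Exp n) :
    (τ x).coeff d = w d * x.coeff d := by
  induction x using AddMonoidAlgebra.induction_linear with
  | zero => simp
  | add x y hx hy => simp [hx, hy, mul_add]
  | single e a =>
    have h : AddMonoidAlgebra.single e a = a • mon K n e := by simp [mon]
    rw [h, map_smul, hw]
    by_cases hde : e = d
    · subst hde; simp [mon, mul_comm]
    · simp [mon, hde]

lemma eigenvalue_add {τ : LR K n ≃ₐ[K] LR K n} {w : Exp n → K}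
    (hw : ∀ d, τ (mon K n d) = w d • mon K n d) (d e : Exp n) : w (d + e) = w d * w e := by
  have h := hw (d + e)
  rw [mon_add, map_mul, hw, hw, smul_mul_smul_comm, ← mon_add] at h
  exact (smul_left_injective K (mon_ne_zero (d + e)) h).symm

lemma eigenvalue_zero {τ : LR K n ≃ₐ[K] LR K n} {w : Exp n → K}
    (hw : ∀ d, τ (mon K n d) = w d • mon K n d) : w 0 = 1 := by
  have h := hw 0
  rw [mon_zero, map_one] at h
  exact smul_left_injective K (one_ne_zero (α := LR K n)) (by simpa using h.symm)

end Monomials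

section Action

variable {K : Type} [Field K] {n : ℕ} {σ : Fin n → (LR K n ≃ₐ[K] LR K n)}

lemma prod_ofFn_zpow_single {G : Type*} [Group G] {m : ℕ} (f : Fin m → G) (j : Fin m) :
    (List.ofFn fun i => f i ^ (Pi.single j 1 : Fin m → ℤ) i).prod = f j := by
  induction m with
  | zero => exact j.elim0
  | succ m ih =>
    rw [List.ofFn_succ, List.prod_cons]
    induction j using Fin.cases with
    | zero => simp [List.ofFn_const]
    | succ j =>
      have h (i : Fin m) :
          (Pi.single j.succ 1 : Fin (m + 1) → ℤ) i.succ = (Pi.single j 1 : Fin m → ℤ) i := by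
        simp [Pi.single_apply]
      simp_rw [h]
      rw [ih (fun i => f i.succ) j]
      simp

lemma IsInvariantIdeal.apply_mem {J : Ideal (LR K n)} (hJ : IsInvariantIdeal K n σ J)
    (i : Fin n) {x : LR K n} (hx : x ∈ J) : σ i x ∈ J := by
  simpa [sigmaZ, prod_ofFn_zpow_single σ i] using hJ (Pi.single i 1) x hx

lemma mem_invariants {x : LR K n} : x ∈ invariants K n σ ↔ ∀ i, σ i x = x := by
  simp [invariants, Algebra.mem_iInf, AlgHom.mem_equalizer]

lemma sigmaZ_apply_of_mem_invariants (g : Fin n → ℤ) {x : LR K n}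
    (hx : x ∈ invariants K n σ) : sigmaZ K n σ g x = x := by
  have h : sigmaZ K n σ g ∈ MulAction.stabilizer (LR K n ≃ₐ[K] LR K n) x := by
    refine Subgroup.list_prod_mem _ fun τ hτ => ?_
    obtain ⟨i, rfl⟩ := List.mem_ofFn.1 hτ
    exact Subgroup.zpow_mem _ (mem_invariants.1 hx i) _
  exact h

lemma isInvariantIdeal_map (I : Ideal (invariants K n σ)) :
    IsInvariantIdeal K n σ (Ideal.map (invariants K n σ).val I) := by
  intro g x hx
  suffices h : Ideal.map (invariants K n σ).val I ≤
      (Ideal.map (invariants K n σ).val I).comap (sigmaZ K n σ g) from h hx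
  refine Ideal.map_le_iff_le_comap.2 fun y hy => ?_
  change sigmaZ K n σ g y ∈ Ideal.map (invariants K n σ).val I
  rw [sigmaZ_apply_of_mem_invariants g y.2]
  exact Ideal.mem_map_of_mem _ hy

variable {w : Fin n → Exp n → K}

lemma mem_invariants_iff_coeff (hw : ∀ i d, σ i (mon K n d) = w i d • mon K n d) {x : LR K n} :
    x ∈ invariants K n σ ↔ ∀ d, x.coeff d ≠ 0 → ∀ i, w i d = 1 := by
  rw [mem_invariants]
  constructor
  · intro h d hd i
    have := coeff_eigen (hw i) x d
    rw [h i] at this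
    exact (mul_eq_right₀ hd).1 this.symm
  · intro h i
    ext d
    rw [coeff_eigen (hw i)]
    by_cases hd : x.coeff d = 0
    · simp [hd]
    · rw [h d hd i, one_mul]

/-- An invariant ideal is generated by its invariant elements. -/
lemma mem_map_comap_of_mem (hw : ∀ i d, σ i (mon K n d) = w i d • mon K n d)
    {J : Ideal (LR K n)} (hJ : IsInvariantIdeal K n σ J) {x : LR K n} (hx : x ∈ J) :
    x ∈ Ideal.map (invariants K n σ).val (Ideal.comap (invariants K n σ).val J) := by
  induction hm : x.coeff.support.card using Nat.strong_induction_on generalizing x with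
  | _ m ih =>
    by_cases hsame : ∀ d ∈ x.coeff.support, ∀ e ∈ x.coeff.support, ∀ i, w i d = w i e
    · rcases x.coeff.support.eq_empty_or_nonempty with h0 | ⟨e, he⟩
      · rw [AddMonoidAlgebra.coeff_eq_zero.1 (Finsupp.support_eq_empty.1 h0)]
        exact zero_mem _
      · have hy : mon K n (-e) * x ∈ invariants K n σ := by
          refine (mem_invariants_iff_coeff hw).2 fun d hd i => ?_
          have hd' : x.coeff (e + d) ≠ 0 := by simpa [mon] using hd
          have h := hsame _ (Finsupp.mem_support_iff.2 hd') e he i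
          rw [eigenvalue_add (hw i)] at h
          refine (mul_eq_left₀ fun h0 => ?_).1 h
          have h1 := eigenvalue_add (hw i) e (-e)
          rw [add_neg_cancel, eigenvalue_zero (hw i), h0, zero_mul] at h1
          exact one_ne_zero h1
        have hx' : x = mon K n e * (mon K n (-e) * x) := by
          rw [← mul_assoc, mon_mul_mon_neg, one_mul]
        rw [hx']
        exact Ideal.mul_mem_left _ _ (Ideal.mem_map_of_mem (invariants K n σ).val
          (x := ⟨_, hy⟩) (J.mul_mem_left _ hx))
    · push Not at hsame
      obtain ⟨d, hd, e, he, i, hne⟩ := hsame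
      have key : ∀ f ∈ x.coeff.support, σ i x - w i f • x ∈
          Ideal.map (invariants K n σ).val (Ideal.comap (invariants K n σ).val J) := by
        intro f hf
        refine ih _ ?_ (J.sub_mem (hJ.apply_mem i hx) (Submodule.smul_of_tower_mem J _ hx)) rfl
        rw [← hm]
        refine Finset.card_lt_card (Finset.ssubset_iff_subset_ne.2 ⟨fun a ha => ?_, fun h => ?_⟩)
        · rw [Finsupp.mem_support_iff] at ha ⊢
          intro h0
          apply ha
          simp [coeff_eigen (hw i), h0]
        · rw [← h] at hf
          apply Finsupp.mem_support_iff.1 hf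
          simp [coeff_eigen (hw i)]
      have hsub : x = (w i d - w i e)⁻¹ • ((σ i x - w i e • x) - (σ i x - w i d • x)) := by
        rw [sub_sub_sub_cancel_left, ← sub_smul, smul_smul, inv_mul_cancel₀ (sub_ne_zero.2 hne),
          one_smul]
      rw [hsub]
      exact Submodule.smul_of_tower_mem _ _ (Ideal.sub_mem _ (key e he) (key d hd))

lemma map_comap_eq (hw : ∀ i d, σ i (mon K n d) = w i d • mon K n d)
    {J : Ideal (LR K n)} (hJ : IsInvariantIdeal K n σ J) :
    Ideal.map (invariants K n σ).val (Ideal.comap (invariants K n σ).val J) = J :=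
  le_antisymm Ideal.map_comap_le fun _ hx => mem_map_comap_of_mem hw hJ hx

open Classical in
/-- The projection onto the monomials of trivial weight. -/
noncomputable def reynolds (w : Fin n → Exp n → K) (x : LR K n) : LR K n :=
  .ofCoeff (x.coeff.filter fun d => ∀ i, w i d = 1)

open Classical in
lemma coeff_reynolds (x : LR K n) (d : Exp n) :
    (reynolds w x).coeff d = if ∀ i, w i d = 1 then x.coeff d else 0 := by
  simp [reynolds, Finsupp.filter_apply]

lemma reynolds_zero : reynolds w (0 : LR K n) = 0 := by
  ext d; simp [coeff_reynolds]

lemma reynolds_add (x y : LR K n) : reynolds w (x + y) = reynolds w x + reynolds w y := by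
  ext d
  simp only [coeff_reynolds, AddMonoidAlgebra.coeff_add, Finsupp.add_apply]
  split_ifs <;> simp

lemma reynolds_mem (hw : ∀ i d, σ i (mon K n d) = w i d • mon K n d) (x : LR K n) :
    reynolds w x ∈ invariants K n σ := by
  classical
  refine (mem_invariants_iff_coeff hw).2 fun d hd => ?_
  by_contra h
  exact hd (by rw [coeff_reynolds, if_neg h])

lemma reynolds_of_mem (hw : ∀ i d, σ i (mon K n d) = w i d • mon K n d) {x : LR K n}
    (hx : x ∈ invariants K n σ) : reynolds w x = x := by
  classical
  ext d
  rw [coeff_reynolds, ite_eq_left_iff]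
  intro h
  by_contra h0
  exact h ((mem_invariants_iff_coeff hw).1 hx d (Ne.symm h0))

lemma reynolds_mul (hw : ∀ i d, σ i (mon K n d) = w i d • mon K n d) (a : LR K n) {m : LR K n}
    (hm : m ∈ invariants K n σ) : reynolds w (a * m) = reynolds w a * m := by
  induction a using AddMonoidAlgebra.induction_linear with
  | zero => simp [reynolds_zero]
  | add x y hx hy => rw [add_mul, reynolds_add, hx, hy, reynolds_add, add_mul]
  | single d b =>
    classical
    have hs : reynolds w (AddMonoidAlgebra.single d b : LR K n) =
        AddMonoidAlgebra.single d (if ∀ i, w i d = 1 then b else 0) := by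
      ext e
      rw [coeff_reynolds]
      by_cases hde : d = e
      · subst hde; simp
      · simp [hde]
    ext e
    rw [hs, coeff_reynolds, AddMonoidAlgebra.coeff_single_mul_apply,
      AddMonoidAlgebra.coeff_single_mul_apply]
    by_cases h0 : m.coeff (-d + e) = 0
    · simp [h0]
    · have h1 := (mem_invariants_iff_coeff hw).1 hm _ h0
      have h2 : ∀ i, w i e = w i d := fun i => by
        have := eigenvalue_add (hw i) d (-d + e)
        rwa [h1 i, mul_one, add_neg_cancel_left] at this
      simp only [h2, ite_mul, zero_mul]

/-- Extending an ideal of the invariant ring and contracting it again gives nothing new. -/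
lemma comap_map_eq (hw : ∀ i d, σ i (mon K n d) = w i d • mon K n d)
    (I : Ideal (invariants K n σ)) :
    Ideal.comap (invariants K n σ).val (Ideal.map (invariants K n σ).val I) = I := by
  refine le_antisymm (fun y hy => ?_) Ideal.le_comap_map
  have key : ∀ x ∈ Ideal.map (invariants K n σ).val I,
      (⟨reynolds w x, reynolds_mem hw x⟩ : invariants K n σ) ∈ I := by
    intro x hx
    induction hx using Submodule.closure_induction with
    | zero =>
      convert I.zero_mem
      exact reynolds_zero
    | add x y _ _ hx hy =>
      convert I.add_mem hx hy
      exact reynolds_add x y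
    | smul_mem a x hx =>
      obtain ⟨m, hm, rfl⟩ := hx
      convert I.mul_mem_left ⟨reynolds w a, reynolds_mem hw a⟩ hm
      exact reynolds_mul hw a m.2
  convert key _ hy
  exact (reynolds_of_mem hw y.2).symm

end Action

/-- For every maximal ideal `𝔫` of `R^{ℤ^n}`, the ideal `R𝔫` is maximal
among proper `ℤ^n`-invariant ideals of `R`; conversely every ideal of `R` maximal among
proper `ℤ^n`-invariant ideals equals `R𝔫` for some maximal ideal `𝔫` of `R^{ℤ^n}`. -/
theorem statement2
    (K : Type) [Field K] (n : ℕ) (hn : 0 < n)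
    (k : ℤ) (hk : k ≠ 0) (r s : Fin n → Fin n → K)
    (hr : ∀ i j, r i j ≠ 0) (hs : ∀ i j, s i j ≠ 0)
    (hroot : ∀ i, ∀ m : ℕ, 0 < m → (r i i / s i i) ^ m ≠ 1)
    (hrs : ∀ i j, i ≠ j → r i j ^ k = s i j ^ k)
    (σ : Fin n → (LR K n ≃ₐ[K] LR K n))
    (hσu : ∀ i j, σ i (U K n j) = (r i j)⁻¹ • U K n j)
    (hσv : ∀ i j, σ i (V K n j) = (s i j)⁻¹ • V K n j)
    :
    (∀ 𝔫 : Ideal (invariants K n σ), 𝔫.IsMaximal →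
        Ideal.map (invariants K n σ).val 𝔫 ≠ ⊤ ∧
        IsInvariantIdeal K n σ (Ideal.map (invariants K n σ).val 𝔫) ∧
        (∀ J : Ideal (LR K n), IsInvariantIdeal K n σ J → J ≠ ⊤ →
          Ideal.map (invariants K n σ).val 𝔫 ≤ J → J = Ideal.map (invariants K n σ).val 𝔫)) ∧
    (∀ J : Ideal (LR K n), IsInvariantIdeal K n σ J → J ≠ ⊤ →
        (∀ J' : Ideal (LR K n), IsInvariantIdeal K n σ J' → J' ≠ ⊤ → J ≤ J' → J' = J) →
        ∃ 𝔫 : Ideal (invariants K n σ), 𝔫.IsMaximal ∧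
          J = Ideal.map (invariants K n σ).val 𝔫) := by
  have hex : ∀ i d, ∃ c : K, σ i (mon K n d) = c • mon K n d := fun i =>
    exists_eigenvalue (σ i) (fun j => ⟨_, inv_ne_zero (hr i j), hσu i j⟩)
      (fun j => ⟨_, inv_ne_zero (hs i j), hσv i j⟩)
  choose w hw using hex
  have map_ne_top : ∀ I : Ideal (invariants K n σ), I ≠ ⊤ →
      Ideal.map (invariants K n σ).val I ≠ ⊤ := by
    intro I hI h
    apply hI
    rw [← comap_map_eq hw I, h, Ideal.comap_top]
  refine ⟨fun 𝔫 h𝔫 => ⟨map_ne_top 𝔫 h𝔫.ne_top, isInvariantIdeal_map 𝔫, fun J hJ hJt hle => ?_⟩,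
    fun J hJ hJt hmax => ?_⟩
  · rw [h𝔫.eq_of_le (Ideal.comap_ne_top _ hJt) (Ideal.map_le_iff_le_comap.1 hle),
      map_comap_eq hw hJ]
  · obtain ⟨𝔫, h𝔫, hle⟩ := Ideal.exists_le_maximal _
      (Ideal.comap_ne_top (invariants K n σ).val hJt)
    refine ⟨𝔫, h𝔫, (hmax _ (isInvariantIdeal_map 𝔫) (map_ne_top 𝔫 h𝔫.ne_top) ?_).symm⟩
    rw [← map_comap_eq hw hJ]
    exact Ideal.map_mono hle

end MTW
end

section
/- Assume K is algebraically closed. Then every maximal ideal 𝔪 of R has trivial stabilizer under the ℤ^n-action: if g ∈ ℤ^n satisfies σ_g(𝔪) = 𝔪, then g = 0. -/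
namespace MTW

/-- An eigenvector of an algebra automorphism is an eigenvector of its integer powers. -/
theorem algEquiv_zpow_apply_of_eigen {K A : Type*} [Field K] [Ring A] [Algebra K A]
    (e : A ≃ₐ[K] A) {x : A} {c : K} (hc : c ≠ 0) (h : e x = c • x) (m : ℤ) :
    (e ^ m) x = c ^ m • x := by
  have hinv : e⁻¹ x = c⁻¹ • x := by
    apply e.injective
    rw [map_smul, h, smul_smul, inv_mul_cancel₀ hc, one_smul]
    exact e.apply_symm_apply x
  induction m with
  | zero => simp
  | succ m ih =>
    rw [zpow_add_one, AlgEquiv.mul_apply, h, map_smul, ih, smul_smul, zpow_add_one₀ hc, mul_comm]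
  | pred m ih =>
    rw [zpow_sub_one, AlgEquiv.mul_apply, hinv, map_smul, ih, smul_smul, zpow_sub_one₀ hc,
      mul_comm]

/-- A common eigenvector of algebra automorphisms is an eigenvector of their product. -/
theorem algEquiv_ofFn_prod_apply_of_eigen {K A : Type*} [Field K] [Ring A] [Algebra K A]
    {x : A} {n : ℕ} (e : Fin n → (A ≃ₐ[K] A)) (c : Fin n → K) (h : ∀ i, e i x = c i • x) :
    (List.ofFn e).prod x = (∏ i, c i) • x := by
  induction n with
  | zero => simp
  | succ n ih =>
    rw [List.ofFn_succ, List.prod_cons, AlgEquiv.mul_apply,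
      ih (fun i => e i.succ) (fun i => c i.succ) fun i => h i.succ, map_smul, h, smul_smul,
      Fin.prod_univ_succ, mul_comm]

theorem sigmaZ_apply_of_eigen {K : Type} [Field K] {n : ℕ} (σ : Fin n → (LR K n ≃ₐ[K] LR K n))
    {x : LR K n} {c : Fin n → K} (hc : ∀ i, c i ≠ 0) (h : ∀ i, σ i x = c i • x)
    (g : Fin n → ℤ) : sigmaZ K n σ g x = (∏ i, c i ^ g i) • x :=
  algEquiv_ofFn_prod_apply_of_eigen _ _ fun i => algEquiv_zpow_apply_of_eigen _ (hc i) (h i) _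

/-- Weak Nullstellensatz: modulo a maximal ideal, every element of a finitely generated
commutative algebra over an algebraically closed field is congruent to a scalar. -/
theorem exists_sub_algebraMap_mem {K A : Type*} [Field K] [IsAlgClosed K] [CommRing A]
    [Algebra K A] [Algebra.FiniteType K A] (I : Ideal A) [I.IsMaximal] (x : A) :
    ∃ a : K, x - algebraMap K A a ∈ I := by
  let := Ideal.Quotient.field I
  have : Algebra.FiniteType K (A ⧸ I) :=
    Algebra.FiniteType.of_surjective (Ideal.Quotient.mkₐ K I) (Ideal.Quotient.mkₐ_surjective K I)
  have : Module.Finite K (A ⧸ I) := finite_of_finite_type_of_isJacobsonRing K (A ⧸ I)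
  obtain ⟨a, ha⟩ := (IsAlgClosed.algebraMap_bijective_of_isIntegral (k := K) (K := A ⧸ I)).2
    (Ideal.Quotient.mk I x)
  exact ⟨a, Ideal.Quotient.eq.mp ha.symm⟩

/-- An algebra automorphism preserving a maximal ideal has no nontrivial eigenvalue on units. -/
theorem eigenvalue_eq_one {K A : Type*} [Field K] [IsAlgClosed K] [CommRing A]
    [Algebra K A] [Algebra.FiniteType K A] (I : Ideal A) [hI : I.IsMaximal] (e : A ≃ₐ[K] A)
    (he : ∀ y ∈ I, e y ∈ I) {x : A} (hx : IsUnit x) {c : K} (h : e x = c • x) : c = 1 := by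
  obtain ⟨a, ha⟩ := exists_sub_algebraMap_mem (K := K) I x
  have h1 := he _ ha
  rw [map_sub, AlgEquiv.commutes, h] at h1
  have h2 : (c - 1) • x ∈ I := by
    rw [sub_smul, one_smul]
    have := I.sub_mem h1 ha
    rwa [sub_sub_sub_cancel_right] at this
  by_contra hc
  rw [Algebra.smul_def] at h2
  exact hI.ne_top (I.eq_top_of_isUnit_mem h2
    (((IsUnit.mk0 _ (sub_ne_zero.mpr hc)).map (algebraMap K A)).mul hx))

instance finiteType_LR (K : Type) [Field K] (n : ℕ) : Algebra.FiniteType K (LR K n) :=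
  have : AddMonoid.FG (Exp n) := AddGroup.fg_iff_addMonoid_fg.mp
    (Module.Finite.iff_addGroup_fg.mp inferInstance)
  inferInstance

theorem eq_zero_of_zpow_eq_one {K : Type*} [Field K] {q : K}
    (hq : ∀ m : ℕ, 0 < m → q ^ m ≠ 1) {m : ℤ} (h : q ^ m = 1) : m = 0 := by
  by_contra hm
  refine hq m.natAbs (Int.natAbs_pos.mpr hm) ?_
  rcases Int.natAbs_eq m with h' | h' <;> rw [h'] at h
  · rwa [zpow_natCast] at h
  · rwa [zpow_neg, zpow_natCast, inv_eq_one] at h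

/-- Over an algebraically closed field, every maximal ideal of `R` has
trivial stabilizer under the `ℤ^n`-action: `σ_g(𝔪) = 𝔪` implies `g = 0`. -/
theorem statement7
    (K : Type) [Field K] [IsAlgClosed K] (n : ℕ) (hn : 0 < n)
    (k : ℤ) (hk : k ≠ 0) (r s : Fin n → Fin n → K)
    (hr : ∀ i j, r i j ≠ 0) (hs : ∀ i j, s i j ≠ 0)
    (hroot : ∀ i, ∀ m : ℕ, 0 < m → (r i i / s i i) ^ m ≠ 1)
    (hrs : ∀ i j, i ≠ j → r i j ^ k = s i j ^ k)
    (σ : Fin n → (LR K n ≃ₐ[K] LR K n))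
    (hσu : ∀ i j, σ i (U K n j) = (r i j)⁻¹ • U K n j)
    (hσv : ∀ i j, σ i (V K n j) = (s i j)⁻¹ • V K n j)
    (𝔪 : Ideal (LR K n)) (h𝔪 : 𝔪.IsMaximal)
    (g : Fin n → ℤ) (hg : Ideal.map (sigmaZ K n σ g) 𝔪 = 𝔪) :
    g = 0 := by
  have hmem : ∀ y ∈ 𝔪, sigmaZ K n σ g y ∈ 𝔪 := fun y hy => by
    have := Ideal.mem_map_of_mem (sigmaZ K n σ g) hy
    rwa [hg] at this
  funext j
  have hu : ∏ i, (r i j)⁻¹ ^ g i = 1 := eigenvalue_eq_one 𝔪 _ hmem (isUnit_mon K n _)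
    (sigmaZ_apply_of_eigen σ (fun i => inv_ne_zero (hr i j)) (fun i => hσu i j) g)
  have hv : ∏ i, (s i j)⁻¹ ^ g i = 1 := eigenvalue_eq_one 𝔪 _ hmem (isUnit_mon K n _)
    (sigmaZ_apply_of_eigen σ (fun i => inv_ne_zero (hs i j)) (fun i => hσv i j) g)
  have hq : ∏ i, (r i j / s i j) ^ (k * g i) = 1 := by
    have h : ∏ i, (r i j / s i j) ^ (k * g i) =
        ((∏ i, (s i j)⁻¹ ^ g i) / ∏ i, (r i j)⁻¹ ^ g i) ^ k := by
      rw [← Finset.prod_div_distrib, ← Finset.prod_zpow]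
      refine Finset.prod_congr rfl fun i _ => ?_
      rw [← div_zpow, inv_div_inv, mul_comm, zpow_mul]
    rw [h, hu, hv, div_one, one_zpow]
  rw [Finset.prod_eq_single j (fun i _ hij => by
    rw [zpow_mul, div_zpow, hrs i j hij, div_self (zpow_ne_zero k (hs i j)), one_zpow])
    (by simp)] at hq
  exact (mul_eq_zero.mp (eq_zero_of_zpow_eq_one (hroot j) hq)).resolve_left hk

end MTW
end

section
/- Let α_1,…,α_n,β_1,…,β_n ∈ K∖{0} and let 𝔪 = (u_1−α_1,…,u_n−α_n,v_1−β_1,…,v_n−β_n) be the corresponding maximal ideal of R. Then for all i ∈ {1,…,n} and all g = (g_1,…,g_n) ∈ ℤ^n: t_i ∈ σ_g(𝔪) if and only if (α_i/β_i)^k = (s_{ii}/r_{ii})^{(g_i+1)k}. -/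
namespace MTW

/-- The maximal ideal `𝔪 = (u₁−α₁,…,uₙ−αₙ,v₁−β₁,…,vₙ−βₙ)` of `R`. -/
noncomputable def mIdeal (K : Type) [Field K] (n : ℕ) (α β : Fin n → K) : Ideal (LR K n) :=
  Ideal.span ((Set.range fun j => U K n j - algebraMap K (LR K n) (α j)) ∪
              (Set.range fun j => V K n j - algebraMap K (LR K n) (β j)))

theorem map_mon_zsmul {K : Type} [Field K] {n : ℕ} {B : Type*} [Ring B] [Algebra K B]
    (φ ψ : LR K n →ₐ[K] B) {c : K} (hc : c ≠ 0) {d : Exp n}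
    (h : φ (mon K n d) = c • ψ (mon K n d)) (m : ℤ) :
    φ (mon K n (m • d)) = c ^ m • ψ (mon K n (m • d)) := by
  have mon_add (d e : Exp n) : mon K n (d + e) = mon K n d * mon K n e := by
    simp [mon, AddMonoidAlgebra.single_mul_single]
  have mon_zero : mon K n 0 = 1 := rfl
  have step (e : Exp n) : φ (mon K n e) = c • ψ (mon K n e) →
      φ (mon K n (-e)) = c⁻¹ • ψ (mon K n (-e)) := by
    intro he
    have h1 : φ (mon K n (-e)) * φ (mon K n e) = 1 := by
      rw [← map_mul, ← mon_add, neg_add_cancel, mon_zero, map_one]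
    have h2 : ψ (mon K n e) * ψ (mon K n (-e)) = 1 := by
      rw [← map_mul, ← mon_add, add_neg_cancel, mon_zero, map_one]
    have h3 : φ (mon K n e) * (c⁻¹ • ψ (mon K n (-e))) = 1 := by
      rw [he, smul_mul_smul_comm, h2, mul_inv_cancel₀ hc, one_smul]
    exact left_inv_eq_right_inv h1 h3
  induction m with
  | zero => simp [mon_zero]
  | succ m ih =>
    rw [add_smul, one_smul, mon_add, map_mul, map_mul, ih, h, smul_mul_smul_comm,
      zpow_add_one₀ hc]
  | pred m ih =>
    rw [sub_smul, one_smul, sub_eq_add_neg, mon_add, map_mul, map_mul, ih, step d h,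
      smul_mul_smul_comm, zpow_sub_one₀ hc]

theorem zpow_apply_of_apply_eq_smul {K A : Type*} [Field K] [Ring A] [Algebra K A]
    {f : A ≃ₐ[K] A} {c : K} (hc : c ≠ 0) {x : A} (h : f x = c • x) (m : ℤ) :
    (f ^ m) x = c ^ m • x := by
  have hinv : f⁻¹ x = c⁻¹ • x := by
    apply f.injective
    rw [map_smul, h, smul_smul, inv_mul_cancel₀ hc, one_smul, ← AlgEquiv.mul_apply,
      mul_inv_cancel, AlgEquiv.one_apply]
  induction m with
  | zero => simp
  | succ m ih =>
    rw [zpow_add_one, AlgEquiv.mul_apply, h, map_smul, ih, smul_smul, zpow_add_one₀ hc, mul_comm]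
  | pred m ih =>
    rw [zpow_sub_one, AlgEquiv.mul_apply, hinv, map_smul, ih, smul_smul, zpow_sub_one₀ hc,
      mul_comm]

theorem prod_ofFn_apply_of_apply_eq_smul {K A : Type*} [Field K] [Ring A] [Algebra K A]
    {n : ℕ} (f : Fin n → A ≃ₐ[K] A) (c : Fin n → K) {x : A} (h : ∀ j, f j x = c j • x) :
    (List.ofFn f).prod x = (∏ j, c j) • x := by
  induction n with
  | zero => simp
  | succ n ih =>
    rw [List.ofFn_succ, List.prod_cons, AlgEquiv.mul_apply,
      ih (fun j => f j.succ) (fun j => c j.succ) (fun j => h j.succ), map_smul, h, smul_smul,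
      Fin.prod_univ_succ, mul_comm]

theorem sigmaZ_mon_zsmul {K : Type} [Field K] {n : ℕ} {σ : Fin n → (LR K n ≃ₐ[K] LR K n)}
    {c : Fin n → K} (hc : ∀ j, c j ≠ 0) {d : Exp n}
    (h : ∀ j, σ j (mon K n d) = (c j)⁻¹ • mon K n d) (g : Fin n → ℤ) (m : ℤ) :
    sigmaZ K n σ g (mon K n (m • d)) = (∏ j, (c j ^ m) ^ g j)⁻¹ • mon K n (m • d) := by
  rw [← Finset.prod_inv_distrib]
  refine prod_ofFn_apply_of_apply_eq_smul _ _ fun j => ?_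
  have hj := map_mon_zsmul (σ j).toAlgHom (AlgHom.id K _) (inv_ne_zero (hc j)) (h j) m
  have := zpow_apply_of_apply_eq_smul (zpow_ne_zero m (inv_ne_zero (hc j))) hj (g j)
  simpa only [inv_zpow] using this

/-- Evaluation of Laurent polynomials at the point `(α, β)`. -/
noncomputable def evalAt {K : Type} [Field K] {n : ℕ} {α β : Fin n → K}
    (hα : ∀ i, α i ≠ 0) (hβ : ∀ i, β i ≠ 0) : LR K n →ₐ[K] K :=
  AddMonoidAlgebra.lift K K (Exp n)
    { toFun := fun d => (∏ j, α j ^ d.toAdd.1 j) * ∏ j, β j ^ d.toAdd.2 j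
      map_one' := by simp
      map_mul' := fun d e => by
        simp only [toAdd_mul, Prod.fst_add, Prod.snd_add, Pi.add_apply,
          zpow_add₀ (hα _), zpow_add₀ (hβ _), Finset.prod_mul_distrib]
        ring }

theorem evalAt_mon {K : Type} [Field K] {n : ℕ} {α β : Fin n → K}
    (hα : ∀ i, α i ≠ 0) (hβ : ∀ i, β i ≠ 0) (d : Exp n) :
    evalAt hα hβ (mon K n d) = (∏ j, α j ^ d.1 j) * ∏ j, β j ^ d.2 j := by
  simp [evalAt, mon, AddMonoidAlgebra.lift_single]

theorem prod_zpow_single {K : Type*} [Field K] {n : ℕ} (α : Fin n → K) (i : Fin n) (m : ℤ) :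
    ∏ j, α j ^ (Pi.single i m : Fin n → ℤ) j = α i ^ m := by
  rw [Finset.prod_eq_single i]
  · simp
  · intro j _ hj
    simp [hj]
  · simp

theorem evalAt_mon_single_left {K : Type} [Field K] {n : ℕ} {α β : Fin n → K}
    (hα : ∀ i, α i ≠ 0) (hβ : ∀ i, β i ≠ 0) (i : Fin n) (m : ℤ) :
    evalAt hα hβ (mon K n (Pi.single i m, 0)) = α i ^ m := by
  simp [evalAt_mon, prod_zpow_single]

theorem evalAt_mon_single_right {K : Type} [Field K] {n : ℕ} {α β : Fin n → K}
    (hα : ∀ i, α i ≠ 0) (hβ : ∀ i, β i ≠ 0) (i : Fin n) (m : ℤ) :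
    evalAt hα hβ (mon K n (0, Pi.single i m)) = β i ^ m := by
  simp [evalAt_mon, prod_zpow_single]

theorem zsmul_single_left {n : ℕ} (i : Fin n) (m : ℤ) :
    m • ((Pi.single i 1, 0) : Exp n) = (Pi.single i m, 0) := by
  ext j <;> simp [Pi.single_apply]

theorem zsmul_single_right {n : ℕ} (i : Fin n) (m : ℤ) :
    m • ((0, Pi.single i 1) : Exp n) = (0, Pi.single i m) := by
  ext j <;> simp [Pi.single_apply]

theorem evalAt_eq_zero_of_mem_mIdeal {K : Type} [Field K] {n : ℕ} {α β : Fin n → K}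
    (hα : ∀ i, α i ≠ 0) (hβ : ∀ i, β i ≠ 0) {x : LR K n} (hx : x ∈ mIdeal K n α β) :
    evalAt hα hβ x = 0 := by
  have hle : mIdeal K n α β ≤ RingHom.ker (evalAt hα hβ) := by
    refine Ideal.span_le.2 ?_
    rintro _ (⟨j, rfl⟩ | ⟨j, rfl⟩) <;>
      simp only [SetLike.mem_coe, RingHom.mem_ker, map_sub, AlgHom.commutes, U, V,
        evalAt_mon_single_left, evalAt_mon_single_right, zpow_one] <;> simp
  exact hle hx

theorem binomial_mem_mIdeal_iff {K : Type} [Field K] {n : ℕ} {α β : Fin n → K}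
    (hα : ∀ i, α i ≠ 0) (hβ : ∀ i, β i ≠ 0) (i : Fin n) (m : ℤ) (a b : K) :
    a • mon K n (Pi.single i m, 0) - b • mon K n (0, Pi.single i m) ∈ mIdeal K n α β ↔
      a * α i ^ m = b * β i ^ m := by
  constructor
  · intro h
    have := evalAt_eq_zero_of_mem_mIdeal hα hβ h
    rwa [map_sub, map_smul, map_smul, evalAt_mon_single_left, evalAt_mon_single_right,
      smul_eq_mul, smul_eq_mul, sub_eq_zero] at this
  · intro h
    let π := Ideal.Quotient.mkₐ K (mIdeal K n α β)
    let ψ := (Algebra.ofId K (LR K n ⧸ mIdeal K n α β)).comp (evalAt hα hβ)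
    have hU : π (mon K n (Pi.single i 1, 0)) = (1 : K) • ψ (mon K n (Pi.single i 1, 0)) := by
      rw [one_smul, AlgHom.comp_apply, evalAt_mon_single_left, zpow_one]
      exact Ideal.Quotient.eq.2 (Ideal.subset_span (Or.inl ⟨i, rfl⟩))
    have hV : π (mon K n (0, Pi.single i 1)) = (1 : K) • ψ (mon K n (0, Pi.single i 1)) := by
      rw [one_smul, AlgHom.comp_apply, evalAt_mon_single_right, zpow_one]
      exact Ideal.Quotient.eq.2 (Ideal.subset_span (Or.inr ⟨i, rfl⟩))
    have hU' := map_mon_zsmul π ψ one_ne_zero hU m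
    have hV' := map_mon_zsmul π ψ one_ne_zero hV m
    rw [zsmul_single_left, one_zpow, one_smul] at hU'
    rw [zsmul_single_right, one_zpow, one_smul] at hV'
    refine Ideal.Quotient.eq_zero_iff_mem.1 ?_
    change π _ = 0
    rw [map_sub, map_smul, map_smul, hU', hV', ← map_smul, ← map_smul, ← map_sub,
      AlgHom.comp_apply, map_sub, map_smul, map_smul, evalAt_mon_single_left,
      evalAt_mon_single_right, smul_eq_mul, smul_eq_mul, h, sub_self, map_zero]

/-- For `𝔪 = (u₁−α₁,…,uₙ−αₙ,v₁−β₁,…,vₙ−βₙ)` with all `αᵢ, βᵢ ≠ 0`,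
and for all `i` and `g ∈ ℤ^n`:
`t_i ∈ σ_g(𝔪)` if and only if `(α_i/β_i)^k = (s_{ii}/r_{ii})^{(g_i+1)k}`. -/
theorem statement8
    (K : Type) [Field K] (n : ℕ) (hn : 0 < n)
    (k : ℤ) (hk : k ≠ 0) (r s : Fin n → Fin n → K)
    (hr : ∀ i j, r i j ≠ 0) (hs : ∀ i j, s i j ≠ 0)
    (hroot : ∀ i, ∀ m : ℕ, 0 < m → (r i i / s i i) ^ m ≠ 1)
    (hrs : ∀ i j, i ≠ j → r i j ^ k = s i j ^ k)
    (σ : Fin n → (LR K n ≃ₐ[K] LR K n))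
    (hσu : ∀ i j, σ i (U K n j) = (r i j)⁻¹ • U K n j)
    (hσv : ∀ i j, σ i (V K n j) = (s i j)⁻¹ • V K n j)
    (α β : Fin n → K) (hα : ∀ i, α i ≠ 0) (hβ : ∀ i, β i ≠ 0)
    (i : Fin n) (g : Fin n → ℤ) :
    tElt K n k r s i ∈ Ideal.map (sigmaZ K n σ g) (mIdeal K n α β) ↔
      (α i / β i) ^ k = (s i i / r i i) ^ ((g i + 1) * k) := by
  have hP := sigmaZ_mon_zsmul (fun j => hr j i) (fun j => hσu j i) g k
  have hQ := sigmaZ_mon_zsmul (fun j => hs j i) (fun j => hσv j i) g k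
  rw [zsmul_single_left] at hP
  rw [zsmul_single_right] at hQ
  set a := ∏ j, (r j i ^ k) ^ g j with ha
  set b := ∏ j, (s j i ^ k) ^ g j with hb
  have ha0 : a ≠ 0 := Finset.prod_ne_zero_iff.2 fun j _ =>
    zpow_ne_zero _ (zpow_ne_zero _ (hr j i))
  have hb0 : b ≠ 0 := Finset.prod_ne_zero_iff.2 fun j _ =>
    zpow_ne_zero _ (zpow_ne_zero _ (hs j i))
  have hden : r i i ^ k - s i i ^ k ≠ 0 := by
    intro h
    have h1 : (r i i / s i i) ^ k = 1 := by
      rw [div_zpow, sub_eq_zero.1 h, div_self (zpow_ne_zero _ (hs i i))]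
    refine hroot i k.natAbs (Int.natAbs_pos.2 hk) ?_
    rcases Int.natAbs_eq k with hk' | hk' <;> rw [hk'] at h1
    · rwa [zpow_natCast] at h1
    · rwa [zpow_neg, inv_eq_one, zpow_natCast] at h1
  have ht : tElt K n k r s i = sigmaZ K n σ g
      (((r i i ^ k - s i i ^ k)⁻¹ * (r i i ^ k * a)) • mon K n (Pi.single i k, 0) -
        ((r i i ^ k - s i i ^ k)⁻¹ * (s i i ^ k * b)) • mon K n (0, Pi.single i k)) := by
    rw [map_sub, map_smul, map_smul, hP, hQ, tElt, smul_sub, smul_smul, smul_smul, smul_smul,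
      smul_smul, ← mul_assoc, mul_inv_cancel_right₀ ha0, ← mul_assoc,
      mul_inv_cancel_right₀ hb0]
  have hmem (x : LR K n) : sigmaZ K n σ g x ∈ Ideal.map (sigmaZ K n σ g) (mIdeal K n α β) ↔
      x ∈ mIdeal K n α β := by
    refine ⟨fun h => ?_, Ideal.mem_map_of_mem _⟩
    obtain ⟨y, hy, hxy⟩ := (Ideal.mem_map_of_equiv (sigmaZ K n σ g) _).1 h
    rwa [← (sigmaZ K n σ g).injective hxy]
  rw [ht, hmem, binomial_mem_mIdeal_iff hα hβ, mul_assoc, mul_assoc (_⁻¹) (s i i ^ k * b),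
    mul_right_inj' (inv_ne_zero hden)]
  have hrest : ∏ j ∈ Finset.univ.erase i, (r j i ^ k) ^ g j =
      ∏ j ∈ Finset.univ.erase i, (s j i ^ k) ^ g j :=
    Finset.prod_congr rfl fun j hj => by rw [hrs j i (Finset.ne_of_mem_erase hj)]
  have hc0 : ∏ j ∈ Finset.univ.erase i, (s j i ^ k) ^ g j ≠ 0 :=
    Finset.prod_ne_zero_iff.2 fun j _ => zpow_ne_zero _ (zpow_ne_zero _ (hs j i))
  rw [ha, hb, ← Finset.mul_prod_erase _ _ (Finset.mem_univ i), hrest,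
    ← Finset.mul_prod_erase _ (fun j => (s j i ^ k) ^ g j) (Finset.mem_univ i)]
  generalize ∏ j ∈ Finset.univ.erase i, (s j i ^ k) ^ g j = c at hc0
  have hexp (x : K) (hx : x ≠ 0) : x ^ ((g i + 1) * k) = x ^ k * (x ^ k) ^ g i := by
    rw [← zpow_mul, ← zpow_add₀ hx]
    ring_nf
  rw [div_zpow, div_zpow, hexp _ (hr i i), hexp _ (hs i i),
    div_eq_div_iff (zpow_ne_zero _ (hβ i))
      (mul_ne_zero (zpow_ne_zero _ (hr i i)) (zpow_ne_zero _ (zpow_ne_zero _ (hr i i))))]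
  constructor <;> intro h
  · refine mul_left_cancel₀ hc0 ?_
    linear_combination h
  · linear_combination c * h

end MTW
end

section
/- The automorphisms τ_1,…,τ_n of P pairwise commute, and for all i,j ∈ {1,…,n} one has τ_i(z_j) = z_j if j < i and τ_i(z_j) = q_i·z_j if j ≥ i. -/
namespace MTW

open MvPolynomial

/-- `z_j = 1 + Σ_{k ≤ j} (q_k − 1) s_k` in `P = K[s_1,…,s_n]` (0-based indexing). -/
noncomputable def zP (K : Type) [Field K] (n : ℕ) (q : Fin n → K) (j : Fin n) :
    MvPolynomial (Fin n) K :=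
  1 + ∑ l ∈ Finset.univ.filter (fun l => l ≤ j), C (q l - 1) * X l

/-- An automorphism acting on the variables as `τ_i` fixes `1 + Σ_{l ∈ S} (q_l − 1) s_l`
when `S` consists of indices below `i`. -/
theorem map_one_add_sum_of_forall_lt {K : Type} [Field K] {n : ℕ} {q : Fin n → K} {i : Fin n}
    {t : MvPolynomial (Fin n) K ≃ₐ[K] MvPolynomial (Fin n) K}
    (hlt : ∀ j, j < i → t (X j) = X j) {S : Finset (Fin n)} (hS : ∀ l ∈ S, l < i) :
    t (1 + ∑ l ∈ S, C (q l - 1) * X l) = 1 + ∑ l ∈ S, C (q l - 1) * X l := by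
  rw [map_add, map_one, map_sum]
  congr 1
  refine Finset.sum_congr rfl fun l hl => ?_
  rw [map_mul, hlt l (hS l hl), ← algebraMap_eq, AlgEquiv.commutes]

/-- An automorphism acting on the variables as `τ_i` scales `1 + Σ_{l ∈ S} (q_l − 1) s_l` by `q_i`
when `S` contains every index up to `i`. -/
theorem map_one_add_sum_of_forall_le {K : Type} [Field K] {n : ℕ} {q : Fin n → K} {i : Fin n}
    {t : MvPolynomial (Fin n) K ≃ₐ[K] MvPolynomial (Fin n) K}
    (hlt : ∀ j, j < i → t (X j) = X j)
    (heq : t (X i) = 1 + C (q i) * X i +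
      ∑ l ∈ Finset.univ.filter (fun l => l < i), C (q l - 1) * X l)
    (hgt : ∀ j, i < j → t (X j) = C (q i) * X j)
    {S : Finset (Fin n)} (hS : ∀ l, l ≤ i → l ∈ S) :
    t (1 + ∑ l ∈ S, C (q l - 1) * X l) = C (q i) * (1 + ∑ l ∈ S, C (q l - 1) * X l) := by
  have hC : ∀ c : K, t (C c) = C c := t.commutes
  have hlow : S.filter (fun l => l < i) = Finset.univ.filter (fun l => l < i) := by
    ext l
    simpa using fun h : l < i => hS l h.le
  have hi : i ∈ S.filter (fun l => ¬ l < i) := by simp [hS i le_rfl]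
  have hlow_map := map_one_add_sum_of_forall_lt (q := q) hlt
    (S := Finset.univ.filter (fun l => l < i)) (by simp)
  have hhigh_map : t (∑ l ∈ (S.filter (fun l => ¬ l < i)).erase i, C (q l - 1) * X l) =
      C (q i) * ∑ l ∈ (S.filter (fun l => ¬ l < i)).erase i, C (q l - 1) * X l := by
    rw [map_sum, Finset.mul_sum]
    refine Finset.sum_congr rfl fun l hl => ?_
    simp only [Finset.mem_erase, Finset.mem_filter, not_lt] at hl
    rw [map_mul, hC, hgt l (lt_of_le_of_ne hl.2.2 (Ne.symm hl.1))]
    ring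
  rw [← Finset.sum_filter_add_sum_filter_not S (fun l => l < i), hlow,
    ← Finset.add_sum_erase _ _ hi, ← add_assoc, map_add, hlow_map, map_add, hhigh_map, map_mul,
    hC, heq]
  simp only [C_sub, C_1]
  ring

/-- The automorphisms `τ_1,…,τ_n` of `P` (defined by
`τ_i(s_j) = s_j` for `j < i`, `τ_i(s_i) = 1 + q_i s_i + Σ_{k<i}(q_k−1)s_k`,
`τ_i(s_j) = q_i s_j` for `j > i`) pairwise commute, and
`τ_i(z_j) = z_j` if `j < i` and `τ_i(z_j) = q_i z_j` if `j ≥ i`. -/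
theorem statement17
    (K : Type) [Field K] (n : ℕ) (q : Fin n → K) (hq : ∀ i, q i ≠ 0)
    (τ : Fin n → (MvPolynomial (Fin n) K ≃ₐ[K] MvPolynomial (Fin n) K))
    (hτ : ∀ i j, τ i (X j) =
      if j < i then X j
      else if j = i then
        1 + C (q i) * X i + ∑ l ∈ Finset.univ.filter (fun l => l < i), C (q l - 1) * X l
      else C (q i) * X j) :
    (∀ i j, ∀ p : MvPolynomial (Fin n) K, τ i (τ j p) = τ j (τ i p)) ∧
    (∀ i j, τ i (zP K n q j) =
      if j < i then zP K n q j else C (q i) * zP K n q j) := by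
  have hC : ∀ i (c : K), τ i (C c) = C c := fun i => (τ i).commutes
  have hlt : ∀ i j, j < i → τ i (X j) = X j := fun i j h => by rw [hτ, if_pos h]
  have heq : ∀ i, τ i (X i) = 1 + C (q i) * X i +
      ∑ l ∈ Finset.univ.filter (fun l => l < i), C (q l - 1) * X l := fun i => by
    rw [hτ, if_neg (lt_irrefl i), if_pos rfl]
  have hgt : ∀ i j, i < j → τ i (X j) = C (q i) * X j := fun i j h => by
    rw [hτ, if_neg h.not_gt, if_neg h.ne']
  constructor
  · have hX : ∀ i j, i < j → ∀ k, τ i (τ j (X k)) = τ j (τ i (X k)) := by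
      intro i j hij k
      rcases lt_trichotomy k j with hkj | rfl | hjk
      · rw [hlt j k hkj]
        rcases lt_trichotomy k i with hki | rfl | hik
        · rw [hlt i k hki, hlt j k hkj]
        · have hw := map_one_add_sum_of_forall_lt (q := q) (hlt j)
            (S := Finset.univ.filter (fun l => l < k)) (by simpa using fun l h => h.trans hij)
          rw [heq k, add_right_comm, map_add, hw, map_mul, hC, hlt j k hkj]
        · rw [hgt i k hik, map_mul, hC, hlt j k hkj]
      · have hw := map_one_add_sum_of_forall_le (hlt i) (heq i) (hgt i)
          (S := Finset.univ.filter (fun l => l < k)) (by simpa using fun l h => h.trans_lt hij)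
        rw [hgt i k hij, map_mul, hC, heq k, add_right_comm, map_add, hw, map_mul, hC,
          hgt i k hij]
        ring
      · rw [hgt j k hjk, hgt i k (hij.trans hjk), map_mul, map_mul, hC, hC, hgt j k hjk,
          hgt i k (hij.trans hjk)]
        ring
    have hcomm : ∀ i j, i < j → ∀ p, τ i (τ j p) = τ j (τ i p) := fun i j hij p =>
      DFunLike.congr_fun (algHom_ext (f := (τ i).toAlgHom.comp (τ j).toAlgHom)
        (g := (τ j).toAlgHom.comp (τ i).toAlgHom) (hX i j hij)) p
    intro i j p
    rcases lt_trichotomy i j with h | rfl | h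
    · exact hcomm i j h p
    · rfl
    · exact (hcomm j i h p).symm
  · intro i j
    unfold zP
    split_ifs with h
    · exact map_one_add_sum_of_forall_lt (hlt i) (by simpa using fun l hl => hl.trans_lt h)
    · exact map_one_add_sum_of_forall_le (hlt i) (heq i) (hgt i)
        (by simpa using fun l hl => hl.trans (not_lt.mp h))

end MTW
end
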